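/- There exist universal constants n₀ ∈ ℕ and c > 0 such that for every n ≥ n₀ and every origin-symmetric convex body B in ℝⁿ with a smooth boundary in the ℓ-position, one has E‖G‖_B / Lip(‖·‖_B) ≥ c·√(log n), where G is the standard Gaussian vector in ℝⁿ and Lip(‖·‖_B) is the Lipschitz constant of ‖·‖_B. -/

import Mathlib

open MeasureTheory ProbabilityTheory Real
open scoped ENNReal NNReal RealInnerProductSpace

noncomputable section

/-- `ℝⁿ` with the Euclidean structure. -/
abbrev Euc (n : ℕ) := EuclideanSpace ℝ (Fin n)

/-- An origin-symmetric convex body in `ℝⁿ`: a compact convex set, symmetric about the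
origin, with `0` in its interior. -/
def IsSymmConvexBody {n : ℕ} (B : Set (Euc n)) : Prop :=
  IsCompact B ∧ Convex ℝ B ∧ (0 : Euc n) ∈ interior B ∧ ∀ x ∈ B, -x ∈ B

/-- The standard Gaussian measure `γₙ` on `ℝⁿ`. -/
def stdGaussian (n : ℕ) : Measure (Euc n) :=
  (Measure.pi fun _ : Fin n => gaussianReal 0 1).map
    ((EuclideanSpace.equiv (Fin n) ℝ).symm)

/-- `B` is in the ℓ-position: `ℓ(B, Id) = 1` (i.e. `E‖G‖_B² = 1`, where `‖·‖_B = gauge B`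
is the Minkowski functional) and every linear operator `U` with `ℓ(B,U) ≤ 1` has
`|det U| ≤ 1`; together these say `sup{|det U| : ℓ(B,U) ≤ 1} = 1 = det Id`. -/
def IsEllPosition {n : ℕ} (B : Set (Euc n)) : Prop :=
  (∫ x, gauge B x ^ 2 ∂stdGaussian n) = 1 ∧
  ∀ U : Euc n →ₗ[ℝ] Euc n,
    (∫ x, gauge B (U x) ^ 2 ∂stdGaussian n) ≤ 1 → |LinearMap.det U| ≤ 1

/-- `B` has a smooth boundary: the Minkowski functional is differentiable away from the
origin. -/
def IsSmoothBody {n : ℕ} (B : Set (Euc n)) : Prop :=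
  ∀ x : Euc n, x ≠ 0 → DifferentiableAt ℝ (gauge B) x

section GaussianSeminorm

variable {E : Type*} [NormedAddCommGroup E] [InnerProductSpace ℝ E] [FiniteDimensional ℝ E]
  {p : Seminorm ℝ E}

/-- A continuous seminorm on a nontrivial Euclidean space attains its Lipschitz constant
at a unit vector. -/
lemma exists_unit_vector_forall_seminorm_le [Nontrivial E] (hp : Continuous p) :
    ∃ θ : E, ‖θ‖ = 1 ∧ ∀ x, p x ≤ p θ * ‖x‖ := by
  obtain ⟨θ, hθ, hmax⟩ := (isCompact_sphere (0 : E) 1).exists_isMaxOn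
    (NormedSpace.sphere_nonempty.2 zero_le_one) hp.continuousOn
  refine ⟨θ, by simpa using hθ, fun x ↦ ?_⟩
  rcases eq_or_ne x 0 with rfl | hx
  · simp
  have hx' : 0 < ‖x‖ := norm_pos_iff.2 hx
  have h : p (‖x‖⁻¹ • x) ≤ p θ := hmax (by simp [norm_smul, hx])
  rw [map_smul_eq_mul, norm_inv, norm_norm, inv_mul_le_iff₀ hx'] at h
  linarith

variable [MeasurableSpace E] [BorelSpace E]

lemma memLp_two_seminorm_comp_stdGaussian (hp : Continuous p) (A : E →L[ℝ] E) :
    MemLp (fun x ↦ p (A x)) 2 (ProbabilityTheory.stdGaussian E) := by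
  obtain ⟨C, -, hC⟩ := Seminorm.bound_of_continuous_normedSpace p hp
  have hA : MemLp (fun x ↦ A x) 2 (ProbabilityTheory.stdGaussian E) :=
    A.comp_memLp' IsGaussian.memLp_two_id
  refine MemLp.of_le_mul (c := C) hA (hp.comp A.continuous).aestronglyMeasurable ?_
  filter_upwards with x
  rw [Real.norm_of_nonneg (apply_nonneg p _)]
  exact hC _

lemma integrable_seminorm_comp_stdGaussian (hp : Continuous p) (A : E →L[ℝ] E) :
    Integrable (fun x ↦ p (A x)) (ProbabilityTheory.stdGaussian E) :=
  (memLp_two_seminorm_comp_stdGaussian hp A).integrable (by norm_num)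

lemma integrable_sq_seminorm_comp_stdGaussian (hp : Continuous p) (A : E →L[ℝ] E) :
    Integrable (fun x ↦ p (A x) ^ 2) (ProbabilityTheory.stdGaussian E) :=
  (memLp_two_seminorm_comp_stdGaussian hp A).integrable_sq

/-- Reverse Hölder inequality for Gaussian seminorms. -/
lemma integral_sq_seminorm_le (hp : Continuous p) :
    ∫ x, p x ^ 2 ∂(ProbabilityTheory.stdGaussian E) ≤
      2 * (∫ x, p x ∂(ProbabilityTheory.stdGaussian E)) ^ 2 := by
  set γ := ProbabilityTheory.stdGaussian E
  have h1 : Integrable (fun x ↦ p x) γ :=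
    integrable_seminorm_comp_stdGaussian hp (ContinuousLinearMap.id ℝ E)
  have h2 : Integrable (fun x ↦ p x ^ 2) γ :=
    integrable_sq_seminorm_comp_stdGaussian hp (ContinuousLinearMap.id ℝ E)
  have hprod : Integrable (fun z : E × E ↦ p z.1 * p z.2) (γ.prod γ) := h1.mul_prod h1
  have hrot : (γ.prod γ).map (ContinuousLinearMap.rotation (Real.pi / 4)) = γ.prod γ :=
    IsGaussian.map_rotation_eq_self (by simpa using! integral_id_stdGaussian) _
  have hmp : MeasurePreserving (ContinuousLinearMap.rotation (Real.pi / 4))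
      (γ.prod γ) (γ.prod γ) := ⟨by fun_prop, hrot⟩
  have hint : ∫ z : E × E, p z.1 * p z.2 ∂(γ.prod γ) = (∫ x, p x ∂γ) ^ 2 := by
    rw [integral_prod_mul (fun x ↦ p x) (fun x ↦ p x), sq]
  have hint' : ∫ z : E × E, p (ContinuousLinearMap.rotation (Real.pi / 4) z).1 *
      p (ContinuousLinearMap.rotation (Real.pi / 4) z).2 ∂(γ.prod γ) = (∫ x, p x ∂γ) ^ 2 := by
    rw [← hint]
    conv_rhs => rw [← hrot]
    rw [integral_map (by fun_prop) (by rw [hrot]; exact hprod.aestronglyMeasurable)]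
  have hfst : Integrable (fun z : E × E ↦ p z.1 ^ 2) (γ.prod γ) := h2.comp_fst γ
  have hsnd : Integrable (fun z : E × E ↦ p z.2 ^ 2) (γ.prod γ) := h2.comp_snd γ
  have hfst' : ∫ z : E × E, p z.1 ^ 2 ∂(γ.prod γ) = ∫ x, p x ^ 2 ∂γ := by
    simpa using integral_fun_fst (μ := γ) (ν := γ) (fun x ↦ p x ^ 2)
  have hsnd' : ∫ z : E × E, p z.2 ^ 2 ∂(γ.prod γ) = ∫ x, p x ^ 2 ∂γ := by
    simpa using integral_fun_snd (μ := γ) (ν := γ) (fun x ↦ p x ^ 2)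
  have hmono : ∫ z : E × E, (2⁻¹ * (p z.1 ^ 2 + p z.2 ^ 2) - p z.1 * p z.2) ∂(γ.prod γ) ≤
      ∫ z : E × E, p (ContinuousLinearMap.rotation (Real.pi / 4) z).1 *
      p (ContinuousLinearMap.rotation (Real.pi / 4) z).2 ∂(γ.prod γ) := by
    refine integral_mono (((hfst.add hsnd).const_mul _).sub hprod)
      (hmp.integrable_comp_of_integrable hprod) fun z ↦ ?_
    obtain ⟨x, y⟩ := z
    have e1 : p (ContinuousLinearMap.rotation (Real.pi / 4) (x, y)).1 = √2 / 2 * p (x + y) := by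
      rw [ContinuousLinearMap.rotation_apply]
      simp only [Real.cos_pi_div_four, Real.sin_pi_div_four]
      rw [← smul_add, map_smul_eq_mul, Real.norm_of_nonneg (by positivity)]
    have e2 : p (ContinuousLinearMap.rotation (Real.pi / 4) (x, y)).2 = √2 / 2 * p (y - x) := by
      rw [ContinuousLinearMap.rotation_apply]
      simp only [Real.cos_pi_div_four, Real.sin_pi_div_four]
      rw [show -(√2 / 2) • x + (√2 / 2) • y = (√2 / 2) • (y - x) by module,
        map_smul_eq_mul, Real.norm_of_nonneg (by positivity)]
    simp only [e1, e2]
    have s2 : √2 * √2 = 2 := Real.mul_self_sqrt (by norm_num)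
    have a1 : |p x - p y| ≤ p (x + y) := by
      simpa using abs_sub_map_le_sub p x (-y)
    have a2 : |p x - p y| ≤ p (y - x) := by
      rw [map_sub_rev]; exact abs_sub_map_le_sub p x y
    have a3 : |p x - p y| * |p x - p y| ≤ p (x + y) * p (y - x) :=
      mul_le_mul a1 a2 (abs_nonneg _) (apply_nonneg _ _)
    rw [abs_mul_abs_self] at a3
    have : √2 / 2 * p (x + y) * (√2 / 2 * p (y - x)) = 2⁻¹ * (p (x + y) * p (y - x)) := by
      linear_combination (p (x + y) * p (y - x) / 4) * s2
    rw [this]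
    linarith
  have hsum : Integrable (fun z : E × E ↦ 2⁻¹ * (p z.1 ^ 2 + p z.2 ^ 2)) (γ.prod γ) :=
    (hfst.add hsnd).const_mul _
  rw [hint', integral_sub hsum hprod, integral_const_mul,
    integral_add hfst hsnd, hfst', hsnd', hint] at hmono
  linarith

variable {θ : E}

lemma indepFun_inner_sub_inner_smul (hθ : ‖θ‖ = 1) :
    IndepFun (fun x : E ↦ ⟪θ, x⟫) (fun x ↦ x - ⟪θ, x⟫ • θ)
      (ProbabilityTheory.stdGaussian E) := by
  have hlaw : HasGaussianLaw (fun x : E ↦ (⟪θ, x⟫, x - ⟪θ, x⟫ • θ))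
      (ProbabilityTheory.stdGaussian E) :=
    IsGaussian.hasGaussianLaw_id.map_fun ((innerSL ℝ θ).prod
      (ContinuousLinearMap.id ℝ E - (innerSL ℝ θ).smulRight θ))
  refine hlaw.indepFun_of_covariance_inner fun s y ↦ ?_
  have h := covarianceBilin_apply_eq_cov (μ := ProbabilityTheory.stdGaussian E)
    IsGaussian.memLp_two_id (s • θ) (y - ⟪θ, y⟫ • θ)
  rw [covarianceBilin_stdGaussian, innerSL_apply_apply] at h
  have e1 : (fun x : E ↦ ⟪s, ⟪θ, x⟫⟫) = fun x ↦ ⟪s • θ, x⟫ := by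
    ext x; simp [real_inner_smul_left, mul_comm]
  have e2 : (fun x : E ↦ ⟪y, x - ⟪θ, x⟫ • θ⟫) = fun x ↦ ⟪y - ⟪θ, y⟫ • θ, x⟫ := by
    ext x
    simp only [inner_sub_left, inner_sub_right, real_inner_smul_left, real_inner_smul_right,
      real_inner_comm y θ]
    ring
  rw [e1, e2, ← h]
  simp [inner_sub_right, real_inner_smul_left, real_inner_smul_right, hθ, mul_comm]

/-- If the norm of the unit vector `θ` is large, projecting along `θ` lowers the second moment
of the seminorm by an amount controlled by the tail of the marginal in the direction `θ`. -/
lemma tail_mul_le_integral_sq_sub (hp : Continuous p) (hθ : ‖θ‖ = 1) {t : ℝ} (ht : 0 ≤ t) :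
    (t ^ 2 * p θ ^ 2 - ∫ x, p x ^ 2 ∂(ProbabilityTheory.stdGaussian E)) *
        (ProbabilityTheory.stdGaussian E).real {x | t ≤ |⟪θ, x⟫|} ≤
      ∫ x, p x ^ 2 ∂(ProbabilityTheory.stdGaussian E) -
        ∫ x, p (x - ⟪θ, x⟫ • θ) ^ 2 ∂(ProbabilityTheory.stdGaussian E) := by
  set γ := ProbabilityTheory.stdGaussian E
  set R : E ≃ₗᵢ[ℝ] E := (ℝ ∙ θ).reflection
  have hR (x : E) : R x = (2 * ⟪θ, x⟫) • θ - x := by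
    simp [R, Submodule.reflection_singleton_apply, hθ, two_mul, add_smul, two_smul]
  have hRγ : MeasurePreserving R γ γ := ⟨by fun_prop, ProbabilityTheory.stdGaussian_map R⟩
  have hD : Integrable (fun x ↦ p x ^ 2) γ :=
    integrable_sq_seminorm_comp_stdGaussian hp (ContinuousLinearMap.id ℝ E)
  have hDR : Integrable (fun x ↦ p (R x) ^ 2) γ := hRγ.integrable_comp_of_integrable hD
  have hDR' : ∫ x, p (R x) ^ 2 ∂γ = ∫ x, p x ^ 2 ∂γ :=
    hRγ.integral_comp R.toHomeomorph.measurableEmbedding (fun x ↦ p x ^ 2)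
  have hDP : Integrable (fun x ↦ p (x - ⟪θ, x⟫ • θ) ^ 2) γ :=
    integrable_sq_seminorm_comp_stdGaussian hp
      (ContinuousLinearMap.id ℝ E - (innerSL ℝ θ).smulRight θ)
  have hmean : ∫ x, 2⁻¹ * (p x ^ 2 + p (R x) ^ 2) ∂γ = ∫ x, p x ^ 2 ∂γ := by
    rw [integral_const_mul, integral_add hD hDR, hDR']; ring
  have hproj (x : E) : p (x - ⟪θ, x⟫ • θ) ^ 2 ≤ 2⁻¹ * (p x ^ 2 + p (R x) ^ 2) := by
    have h : p (x - ⟪θ, x⟫ • θ) ≤ 2⁻¹ * (p x + p (R x)) := by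
      have e : x - ⟪θ, x⟫ • θ = (2⁻¹ : ℝ) • (x - R x) := by rw [hR]; module
      rw [e, map_smul_eq_mul, Real.norm_of_nonneg (by norm_num)]
      gcongr
      exact map_sub_le_add p _ _
    nlinarith [sq_nonneg (p x - p (R x)), apply_nonneg p (x - ⟪θ, x⟫ • θ),
      apply_nonneg p x, apply_nonneg p (R x)]
  have hlarge (x : E) : ⟪θ, x⟫ ^ 2 * p θ ^ 2 ≤ 2⁻¹ * (p x ^ 2 + p (R x) ^ 2) := by
    have h : |⟪θ, x⟫| * p θ ≤ 2⁻¹ * (p x + p (R x)) := by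
      have e : (⟪θ, x⟫) • θ = (2⁻¹ : ℝ) • (x + R x) := by rw [hR]; module
      rw [← Real.norm_eq_abs, ← map_smul_eq_mul, e, map_smul_eq_mul,
        Real.norm_of_nonneg (by norm_num)]
      gcongr
      exact map_add_le_add p _ _
    have h' : 0 ≤ |⟪θ, x⟫| * p θ := mul_nonneg (abs_nonneg _) (apply_nonneg _ _)
    have h'' := pow_le_pow_left₀ h' h 2
    rw [mul_pow, sq_abs] at h''
    nlinarith [sq_nonneg (p x - p (R x))]
  set A : Set E := {x | t ≤ |⟪θ, x⟫|}
  have hA : MeasurableSet A := measurableSet_le (by fun_prop) (by fun_prop)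
  have hind : ∫ x, A.indicator 1 x * p (x - ⟪θ, x⟫ • θ) ^ 2 ∂γ =
      γ.real A * ∫ x, p (x - ⟪θ, x⟫ • θ) ^ 2 ∂γ := by
    have hT : MeasurableSet {s : ℝ | t ≤ |s|} := measurableSet_le (by fun_prop) (by fun_prop)
    have h := (indepFun_inner_sub_inner_smul hθ).integral_comp_mul_comp
      (f := {s : ℝ | t ≤ |s|}.indicator (1 : ℝ → ℝ)) (g := fun y ↦ p y ^ 2)
      (by fun_prop) (by fun_prop)
      ((measurable_one.indicator hT).aestronglyMeasurable)
      (hp.pow 2).aestronglyMeasurable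
    rw [← integral_indicator_one hA]
    exact h
  have hA1 : Integrable (A.indicator (1 : E → ℝ)) γ := (integrable_const 1).indicator hA
  have hA2 : Integrable (fun x ↦ A.indicator 1 x * p (x - ⟪θ, x⟫ • θ) ^ 2) γ := by
    refine (hDP.indicator hA).congr (.of_forall fun x ↦ ?_)
    by_cases hx : x ∈ A <;> simp [hx]
  have hmono : ∫ x, (A.indicator 1 x * (t ^ 2 * p θ ^ 2) + (p (x - ⟪θ, x⟫ • θ) ^ 2 -
      A.indicator 1 x * p (x - ⟪θ, x⟫ • θ) ^ 2)) ∂γ ≤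
      ∫ x, 2⁻¹ * (p x ^ 2 + p (R x) ^ 2) ∂γ := by
    refine integral_mono ((hA1.mul_const _).add (hDP.sub hA2)) ((hD.add hDR).const_mul _)
      fun x ↦ ?_
    by_cases hx : x ∈ A
    · have : t ^ 2 ≤ ⟪θ, x⟫ ^ 2 := by
        rw [← sq_abs ⟪θ, x⟫]; exact pow_le_pow_left₀ ht hx 2
      have := mul_le_mul_of_nonneg_right this (sq_nonneg (p θ))
      simpa [hx] using this.trans (hlarge x)
    · simpa [hx] using hproj x
  have hPle : ∫ x, p (x - ⟪θ, x⟫ • θ) ^ 2 ∂γ ≤ ∫ x, p x ^ 2 ∂γ :=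
    hmean ▸ integral_mono hDP ((hD.add hDR).const_mul _) hproj
  have hsub : Integrable (fun x ↦ p (x - ⟪θ, x⟫ • θ) ^ 2 -
      A.indicator 1 x * p (x - ⟪θ, x⟫ • θ) ^ 2) γ := hDP.sub hA2
  rw [hmean, integral_add (hA1.mul_const _) hsub, integral_sub hDP hA2, hind,
    integral_mul_const, integral_indicator_one hA] at hmono
  nlinarith [measureReal_nonneg (μ := γ) (s := A)]

lemma map_inner_stdGaussian (hθ : ‖θ‖ = 1) :
    (ProbabilityTheory.stdGaussian E).map (fun x ↦ ⟪θ, x⟫) = gaussianReal 0 1 := by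
  have h := IsGaussian.map_eq_gaussianReal (μ := ProbabilityTheory.stdGaussian E) (innerSL ℝ θ)
  rw [integral_strongDual_stdGaussian, variance_dual_stdGaussian, innerSL_apply_norm, hθ] at h
  simpa using h

end GaussianSeminorm

lemma exp_div_sqrt_le_gaussianReal_tail {t : ℝ} (ht : 0 ≤ t) :
    exp (-(t + 1) ^ 2 / 2) / √(2 * π) ≤ (gaussianReal 0 1).real {s | t ≤ |s|} := by
  have hsub : Set.Icc t (t + 1) ⊆ {s | t ≤ |s|} := fun s hs ↦ hs.1.trans (le_abs_self s)
  refine le_trans ?_ (measureReal_mono hsub)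
  rw [measureReal_def, gaussianReal_apply_eq_integral _ one_ne_zero,
    ENNReal.toReal_ofReal (integral_nonneg fun _ ↦ gaussianPDFReal_nonneg _ _ _)]
  calc exp (-(t + 1) ^ 2 / 2) / √(2 * π)
      = ∫ _ in Set.Icc t (t + 1), exp (-(t + 1) ^ 2 / 2) / √(2 * π) := by simp
    _ ≤ ∫ s in Set.Icc t (t + 1), gaussianPDFReal 0 1 s := by
      refine setIntegral_mono_on (by simp) (integrable_gaussianPDFReal 0 1).integrableOn
        measurableSet_Icc fun s hs ↦ ?_
      have h : s ^ 2 ≤ (t + 1) ^ 2 := pow_le_pow_left₀ (ht.trans hs.1) hs.2 2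
      rw [gaussianPDFReal_def, div_eq_inv_mul]
      simp only [NNReal.coe_one, mul_one, sub_zero]
      gcongr

section Position

variable {E : Type*} [NormedAddCommGroup E] [InnerProductSpace ℝ E] [FiniteDimensional ℝ E]
  [MeasurableSpace E] [BorelSpace E] {p : Seminorm ℝ E} {θ : E}

/-- In the ℓ-position, projecting along a unit vector lowers the second moment by at most `3/n`. -/
lemma one_sub_integral_sq_proj_le (hp : Continuous p) (hθ : ‖θ‖ = 1)
    (h1 : ∫ x, p x ^ 2 ∂(ProbabilityTheory.stdGaussian E) = 1)
    (hdet : ∀ U : E →ₗ[ℝ] E, ∫ x, p (U x) ^ 2 ∂(ProbabilityTheory.stdGaussian E) ≤ 1 →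
      |LinearMap.det U| ≤ 1) :
    Module.finrank ℝ E *
      (1 - ∫ x, p (x - ⟪θ, x⟫ • θ) ^ 2 ∂(ProbabilityTheory.stdGaussian E)) ≤ 3 := by
  set γ := ProbabilityTheory.stdGaussian E
  set n := Module.finrank ℝ E
  set q := ∫ x, p (x - ⟪θ, x⟫ • θ) ^ 2 ∂γ
  have hq : 0 ≤ q := integral_nonneg fun _ ↦ sq_nonneg _
  have hD : Integrable (fun x ↦ p x ^ 2) γ :=
    integrable_sq_seminorm_comp_stdGaussian hp (ContinuousLinearMap.id ℝ E)
  have hDP : Integrable (fun x ↦ p (x - ⟪θ, x⟫ • θ) ^ 2) γ :=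
    integrable_sq_seminorm_comp_stdGaussian hp
      (ContinuousLinearMap.id ℝ E - (innerSL ℝ θ).smulRight θ)
  set J : ℝ := 2⁻¹ * (1 + q)
  have hJ : 0 < J := by positivity
  set U : E →ₗ[ℝ] E :=
    (√J)⁻¹ • LinearMap.transvection (innerSL ℝ θ).toLinearMap (-(2⁻¹ : ℝ) • θ)
  have hU (x : E) : p (U x) ^ 2 ≤ J⁻¹ * (2⁻¹ * (p x ^ 2 + p (x - ⟪θ, x⟫ • θ) ^ 2)) := by
    have e : U x = (√J)⁻¹ • ((2⁻¹ : ℝ) • (x + (x - ⟪θ, x⟫ • θ))) := by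
      simp only [U, LinearMap.smul_apply, LinearMap.transvection.apply,
        ContinuousLinearMap.coe_coe, innerSL_apply_apply]
      module
    rw [e, map_smul_eq_mul, map_smul_eq_mul, Real.norm_of_nonneg (by positivity),
      Real.norm_of_nonneg (by norm_num), mul_pow, inv_pow, Real.sq_sqrt hJ.le]
    gcongr
    have := map_add_le_add p x (x - ⟪θ, x⟫ • θ)
    have := pow_le_pow_left₀ (apply_nonneg p _) this 2
    nlinarith [sq_nonneg (p x - p (x - ⟪θ, x⟫ • θ))]
  have hUint : ∫ x, p (U x) ^ 2 ∂γ ≤ 1 := by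
    calc ∫ x, p (U x) ^ 2 ∂γ
        ≤ ∫ x, J⁻¹ * (2⁻¹ * (p x ^ 2 + p (x - ⟪θ, x⟫ • θ) ^ 2)) ∂γ :=
          integral_mono_of_nonneg (.of_forall fun _ ↦ sq_nonneg _)
            (((hD.add hDP).const_mul _).const_mul _) (.of_forall hU)
      _ = 1 := by
          rw [integral_const_mul, integral_const_mul, integral_add hD hDP, h1]
          exact inv_mul_cancel₀ hJ.ne'
  have hd := hdet U hUint
  have hdetU : LinearMap.det U = (√J)⁻¹ ^ n * 2⁻¹ := by
    rw [LinearMap.det_smul, LinearMap.transvection.det]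
    simp only [ContinuousLinearMap.coe_coe, innerSL_apply_apply, real_inner_smul_right,
      real_inner_self_eq_norm_sq, hθ]
    congr 1
    norm_num
  rw [hdetU, abs_of_nonneg (by positivity), inv_pow, inv_mul_le_iff₀ (by positivity),
    mul_one] at hd
  have hJn : 4⁻¹ ≤ J ^ n := by
    have h := pow_le_pow_left₀ (by norm_num) hd 2
    rw [← pow_mul, mul_comm n 2, pow_mul, Real.sq_sqrt hJ.le] at h
    norm_num at h ⊢
    exact h
  have hJexp : J ^ n ≤ exp (-(n * (1 - q) / 2)) := by
    calc J ^ n ≤ exp (-((1 - q) / 2)) ^ n := by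
          refine pow_le_pow_left₀ hJ.le ?_ n
          have := Real.add_one_le_exp (-((1 - q) / 2))
          simp only [J]
          linarith
      _ = exp (-(n * (1 - q) / 2)) := by rw [← Real.exp_nat_mul]; ring_nf
  have hlog := Real.log_le_log (by norm_num) (hJn.trans hJexp)
  rw [Real.log_exp, Real.log_inv, show (4 : ℝ) = 2 ^ 2 by norm_num, Real.log_pow] at hlog
  push_cast at hlog
  linarith [Real.log_two_lt_d9]

/-- In the ℓ-position, the norm of every unit vector is at most of order `1/√(log n)`. -/
lemma log_finrank_mul_sq_le (hp : Continuous p) (hθ : ‖θ‖ = 1)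
    (hn : 81 ≤ Module.finrank ℝ E)
    (h1 : ∫ x, p x ^ 2 ∂(ProbabilityTheory.stdGaussian E) = 1)
    (hdet : ∀ U : E →ₗ[ℝ] E, ∫ x, p (U x) ^ 2 ∂(ProbabilityTheory.stdGaussian E) ≤ 1 →
      |LinearMap.det U| ≤ 1) :
    Real.log (Module.finrank ℝ E) * p θ ^ 2 ≤ 8 := by
  rcases (apply_nonneg p θ).eq_or_lt with hb | hb
  · rw [← hb]; norm_num
  set n := Module.finrank ℝ E
  have hn' : (81 : ℝ) ≤ n := by exact_mod_cast hn
  have ht : 0 ≤ 2 / p θ := by positivity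
  have h := tail_mul_le_integral_sq_sub hp hθ ht
  have hb2 : (2 / p θ) ^ 2 * p θ ^ 2 = 4 := by field_simp; norm_num
  rw [h1, hb2] at h
  have hproj := one_sub_integral_sq_proj_le hp hθ h1 hdet
  have hT : MeasurableSet {s : ℝ | 2 / p θ ≤ |s|} :=
    measurableSet_le (by fun_prop) (by fun_prop)
  have htail := exp_div_sqrt_le_gaussianReal_tail ht
  rw [← map_inner_stdGaussian hθ, map_measureReal_apply (by fun_prop) hT] at htail
  change _ ≤ (ProbabilityTheory.stdGaussian E).real {x | 2 / p θ ≤ |⟪θ, x⟫|} at htail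
  set t := 2 / p θ
  have hmul : n * (exp (-(t + 1) ^ 2 / 2) / √(2 * π)) ≤ 1 := by
    have := mul_le_mul_of_nonneg_left htail (Nat.cast_nonneg (α := ℝ) n)
    have := mul_le_mul_of_nonneg_left h (Nat.cast_nonneg (α := ℝ) n)
    linarith
  have hsqrt : √(2 * π) ≤ exp 1 := by
    rw [Real.sqrt_le_left (by positivity)]
    have h1 := Real.exp_one_gt_d9
    have h2 := Real.pi_lt_d2
    nlinarith
  have hn_le : (n : ℝ) ≤ exp (1 + (t + 1) ^ 2 / 2) := by
    have e : exp (-(t + 1) ^ 2 / 2) = (exp ((t + 1) ^ 2 / 2))⁻¹ := by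
      rw [← Real.exp_neg]; ring_nf
    rw [e, inv_div_left, ← div_eq_mul_inv, div_le_one (by positivity)] at hmul
    rw [Real.exp_add]
    exact hmul.trans (mul_le_mul_of_nonneg_right hsqrt (Real.exp_nonneg _))
  have hlog := Real.log_le_log (by linarith) hn_le
  rw [Real.log_exp] at hlog
  have hlog4 : 4 ≤ Real.log n := by
    rw [Real.le_log_iff_exp_le (by linarith)]
    have h3 : exp 4 = exp 1 ^ 4 := by rw [← Real.exp_nat_mul]; norm_num
    have h4 : exp 1 ^ 4 ≤ 3 ^ 4 :=
      pow_le_pow_left₀ (by positivity) (by linarith [Real.exp_one_lt_d9]) 4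
    linarith
  have hlogt : Real.log n ≤ 2 * t ^ 2 := by nlinarith [sq_nonneg (t - 1)]
  have := mul_le_mul_of_nonneg_right hlogt (sq_nonneg (p θ))
  linarith

end Position

lemma stdGaussian_eq_probabilityTheory_stdGaussian (n : ℕ) :
    _root_.stdGaussian n = ProbabilityTheory.stdGaussian (Euc n) :=
  map_pi_eq_stdGaussian

/-- **Critical dimension in the ℓ-position**: for a smooth origin-symmetric convex body in
the ℓ-position, `E‖G‖_B / Lip(‖·‖_B) ≥ c·√(log n)` (stated via a Lipschitz constant `L`
of `‖·‖_B`, witnessed by its least value). -/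
theorem ell_position_critical_dimension :
    ∃ (n₀ : ℕ) (c : ℝ), 0 < c ∧ ∀ n : ℕ, n₀ ≤ n →
      ∀ B : Set (Euc n), IsSymmConvexBody B → IsSmoothBody B → IsEllPosition B →
      ∃ L : ℝ≥0, LipschitzWith L (gauge B) ∧
        c * Real.sqrt (Real.log n) * (L : ℝ) ≤ ∫ x, gauge B x ∂stdGaussian n := by
  refine ⟨81, 4⁻¹, by norm_num, fun n hn B hB _ hell ↦ ?_⟩
  obtain ⟨-, hconv, h0, hsymm⟩ := hB
  obtain ⟨h1, hdet⟩ := hell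
  have h0' : B ∈ nhds (0 : Euc n) := mem_interior_iff_mem_nhds.1 h0
  let p : Seminorm ℝ (Euc n) := Seminorm.of (gauge B)
    (gauge_add_le hconv (absorbent_nhds_zero h0')) fun r x ↦ by
      rcases le_total 0 r with hr | hr
      · rw [gauge_smul_of_nonneg hr, Real.norm_of_nonneg hr, smul_eq_mul]
      · rw [← gauge_neg hsymm, ← neg_smul, gauge_smul_of_nonneg (neg_nonneg.2 hr),
          Real.norm_of_nonpos hr, smul_eq_mul]
  have hp : Continuous p := continuous_gauge hconv h0'
  rw [stdGaussian_eq_probabilityTheory_stdGaussian] at h1 hdet ⊢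
  change ∫ x, p x ^ 2 ∂_ = 1 at h1
  change ∀ U : Euc n →ₗ[ℝ] Euc n, ∫ x, p (U x) ^ 2 ∂_ ≤ 1 → |LinearMap.det U| ≤ 1 at hdet
  change ∃ L : ℝ≥0, LipschitzWith L p ∧
    4⁻¹ * √(Real.log n) * (L : ℝ) ≤ ∫ x, p x ∂_
  have : NeZero n := ⟨by omega⟩
  obtain ⟨θ, hθ, hmax⟩ := exists_unit_vector_forall_seminorm_le hp
  refine ⟨NNReal.mk (p θ) (apply_nonneg p θ), .of_dist_le_mul fun x y ↦ ?_, ?_⟩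
  · rw [Real.dist_eq, dist_eq_norm]
    exact (abs_sub_map_le_sub p x y).trans (hmax _)
  have hlog := log_finrank_mul_sq_le hp hθ (by simpa using hn) h1 hdet
  rw [finrank_euclideanSpace_fin] at hlog
  have hL1 := integral_sq_seminorm_le hp
  rw [h1] at hL1
  refine le_of_sq_le_sq ?_ (integral_nonneg fun _ ↦ apply_nonneg p _)
  have hlog0 : 0 ≤ Real.log n := Real.log_natCast_nonneg n
  change (4⁻¹ * √(Real.log n) * p θ) ^ 2 ≤ _
  rw [mul_pow, mul_pow, Real.sq_sqrt hlog0]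
  linarith
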